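/- The shifted theta function satisfies Θ(τ + 1/2) = η(τ)² / η(2τ), equivalently Σ_{n∈ℤ} (−1)^n q^{n²} = (q;q)_∞² / (q²;q²)_∞ as formal power series in q. -/

import Mathlib

open Complex

open scoped Real

/-- Dedekind eta function `η(τ) = e^{πiτ/12} ∏_{n ≥ 1} (1 − e^{2πinτ})`. -/
noncomputable def dedekindEta (τ : ℂ) : ℂ :=
  Complex.exp (π * I * τ / 12) * ∏' n : ℕ, (1 - Complex.exp (2 * π * I * τ) ^ (n + 1))

/-- Theta function `Θ(τ) = Σ_{n ∈ ℤ} e^{2πi n² τ}`. -/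
noncomputable def jacobiThetaQ (τ : ℂ) : ℂ :=
  ∑' n : ℤ, Complex.exp (2 * π * I * (n : ℂ) ^ 2 * τ)

open Finset Filter Topology

/-- The finite `q`-Pochhammer symbol `(q; q)_n = ∏_{i = 1}^n (1 - q ^ i)`. -/
def qFactorial {R : Type*} [CommRing R] (q : R) (n : ℕ) : R :=
  ∏ i ∈ range n, (1 - q ^ (i + 1))

section Field

variable {K : Type*} [Field K]

lemma one_sub_pow_div_qFactorial_succ {q : K} (h : ∀ n, qFactorial q n ≠ 0) (n : ℕ) :
    (1 - q ^ (n + 1)) / qFactorial q (n + 1) = 1 / qFactorial q n := by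
  have h1 := h (n + 1)
  rw [qFactorial, prod_range_succ, ← qFactorial] at h1 ⊢
  have h2 := right_ne_zero_of_mul h1
  have h3 := h n
  field_simp

/-- The `q`-binomial theorem, in homogeneous form. -/
theorem prod_add_mul_pow_eq_sum_antidiagonal {q : K} (h : ∀ n, qFactorial q n ≠ 0)
    (x y : K) (m : ℕ) :
    ∏ i ∈ range m, (y + x * q ^ i) =
      qFactorial q m * ∑ p ∈ antidiagonal m,
        q ^ p.1.choose 2 * x ^ p.1 * y ^ p.2 / (qFactorial q p.1 * qFactorial q p.2) := by
  induction m generalizing x with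
  | zero => simp [qFactorial]
  | succ m ih =>
    set a : ℕ × ℕ → K := fun p ↦
      q ^ p.1.choose 2 * x ^ p.1 * y ^ p.2 / (qFactorial q p.1 * qFactorial q p.2) with ha
    set b : ℕ × ℕ → K := fun p ↦
      q ^ p.1.choose 2 * (x * q) ^ p.1 * y ^ p.2 / (qFactorial q p.1 * qFactorial q p.2) with hb
    have hsplit : (1 - q ^ (m + 1)) * ∑ p ∈ antidiagonal (m + 1), a p =
        ∑ p ∈ antidiagonal (m + 1), q ^ p.1 * (1 - q ^ p.2) * a p +
          ∑ p ∈ antidiagonal (m + 1), (1 - q ^ p.1) * a p := by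
      rw [mul_sum, ← sum_add_distrib]
      refine sum_congr rfl fun p hp ↦ ?_
      rw [← HasAntidiagonal.mem_antidiagonal.mp hp]
      ring
    have hleft : ∑ p ∈ antidiagonal (m + 1), q ^ p.1 * (1 - q ^ p.2) * a p =
        y * ∑ p ∈ antidiagonal m, b p := by
      rw [Nat.sum_antidiagonal_succ', mul_sum]
      simp only [pow_zero, sub_self, mul_zero, zero_mul, zero_add]
      refine sum_congr rfl fun p _ ↦ ?_
      have := one_sub_pow_div_qFactorial_succ h p.2
      simp only [ha, hb]
      calc _ = q ^ p.1 * (q ^ p.1.choose 2 * x ^ p.1 * y ^ (p.2 + 1)) / qFactorial q p.1 *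
            ((1 - q ^ (p.2 + 1)) / qFactorial q (p.2 + 1)) := by
              simp only [div_eq_mul_inv, mul_inv]; ring
        _ = _ := by rw [this]; simp only [div_eq_mul_inv, mul_inv, mul_pow]; ring
    have hright : ∑ p ∈ antidiagonal (m + 1), (1 - q ^ p.1) * a p =
        x * ∑ p ∈ antidiagonal m, b p := by
      rw [Nat.sum_antidiagonal_succ, mul_sum]
      simp only [pow_zero, sub_self, zero_mul, zero_add]
      refine sum_congr rfl fun p _ ↦ ?_
      have := one_sub_pow_div_qFactorial_succ h p.1
      simp only [ha, hb]
      calc _ = q ^ (p.1 + 1).choose 2 * x ^ (p.1 + 1) * y ^ p.2 / qFactorial q p.2 *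
            ((1 - q ^ (p.1 + 1)) / qFactorial q (p.1 + 1)) := by
              simp only [div_eq_mul_inv, mul_inv]; ring
        _ = _ := by
          rw [this, Nat.choose_succ_succ' p.1 1, Nat.choose_one_right]
          simp only [div_eq_mul_inv, mul_inv, mul_pow]; ring
    have hfac : qFactorial q (m + 1) = qFactorial q m * (1 - q ^ (m + 1)) :=
      prod_range_succ _ _
    rw [hfac, mul_assoc, hsplit, hleft, hright, prod_range_succ', ← add_mul,
      mul_left_comm, ← ih (x * q)]
    rw [mul_comm]
    congr 1
    · ring
    · exact prod_congr rfl fun i _ ↦ by ring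

lemma prod_pow_odd (r : K) (n : ℕ) : ∏ i ∈ range n, r ^ (2 * i + 1) = r ^ n ^ 2 := by
  induction n with
  | zero => simp
  | succ n ih => rw [prod_range_succ, ih]; ring

lemma prod_pow_add_pow_odd (r : K) (n : ℕ) :
    ∏ i ∈ range (2 * n), (r ^ (2 * n) + r * (r ^ 2) ^ i) =
      r ^ (3 * n ^ 2) * (∏ i ∈ range n, (1 + r ^ (2 * i + 1))) ^ 2 := by
  have hlow : ∏ i ∈ range n, (r ^ (2 * n) + r * (r ^ 2) ^ i) =
      r ^ n ^ 2 * ∏ i ∈ range n, (1 + r ^ (2 * i + 1)) := by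
    rw [← prod_pow_odd, ← prod_range_reflect (fun i ↦ 1 + r ^ (2 * i + 1)), ← prod_mul_distrib]
    refine prod_congr rfl fun i hi ↦ ?_
    obtain ⟨l, rfl⟩ := Nat.exists_eq_add_of_lt (mem_range.mp hi)
    rw [show i + l + 1 - 1 - i = l by omega]
    ring
  have hhigh : ∏ i ∈ range n, (r ^ (2 * n) + r * (r ^ 2) ^ (n + i)) =
      r ^ (2 * n ^ 2) * ∏ i ∈ range n, (1 + r ^ (2 * i + 1)) := by
    rw [show r ^ (2 * n ^ 2) = ∏ _i ∈ range n, r ^ (2 * n) by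
      rw [prod_const, card_range]; ring, ← prod_mul_distrib]
    exact prod_congr rfl fun i _ ↦ by ring
  rw [two_mul n, prod_range_add, ← two_mul, hlow, hhigh]
  ring

/-- The `k`-th term of the finite form of the theta series: `r ^ k²` weighted by the
`r²`-binomial coefficient `[2n, n + k]`, and `0` for `|k| > n`. -/
noncomputable def finiteThetaTerm (r : K) (n : ℕ) (k : ℤ) : K :=
  if k ∈ Icc (-n : ℤ) n then
    r ^ k.natAbs ^ 2 * (qFactorial (r ^ 2) (2 * n) *
      ((qFactorial (r ^ 2) (n + k).toNat)⁻¹ * (qFactorial (r ^ 2) (n - k).toNat)⁻¹))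
  else 0

/-- Finite form of the Jacobi triple product at `z = 1`. -/
theorem sum_finiteThetaTerm {r : K} (hr : r ≠ 0) (h : ∀ n, qFactorial (r ^ 2) n ≠ 0) (n : ℕ) :
    ∑ k ∈ Icc (-n : ℤ) n, finiteThetaTerm r n k = (∏ i ∈ range n, (1 + r ^ (2 * i + 1))) ^ 2 := by
  refine mul_left_cancel₀ (pow_ne_zero (3 * n ^ 2) hr) ?_
  rw [← prod_pow_add_pow_odd, prod_add_mul_pow_eq_sum_antidiagonal h, mul_sum, mul_sum]
  refine sum_nbij' (fun k ↦ ((n + k).toNat, (n - k).toNat)) (fun p ↦ (p.1 : ℤ) - n)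
    ?_ ?_ ?_ ?_ ?_
  · intro k hk
    rw [mem_Icc] at hk
    rw [HasAntidiagonal.mem_antidiagonal]
    omega
  · intro p hp
    rw [HasAntidiagonal.mem_antidiagonal] at hp
    rw [mem_Icc]
    omega
  · intro k hk
    rw [mem_Icc] at hk
    dsimp only
    omega
  · intro p hp
    rw [HasAntidiagonal.mem_antidiagonal] at hp
    ext <;> dsimp only <;> omega
  · intro k hk
    rw [finiteThetaTerm, if_pos hk]
    rw [mem_Icc] at hk
    obtain ⟨j, hj⟩ := Int.eq_ofNat_of_zero_le (show 0 ≤ n + k by omega)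
    obtain ⟨l, hl⟩ := Int.eq_ofNat_of_zero_le (show 0 ≤ n - k by omega)
    dsimp only
    rw [hj, hl, Int.toNat_natCast, Int.toNat_natCast]
    have hexp : 3 * n ^ 2 + k.natAbs ^ 2 = 2 * j.choose 2 + j + 2 * n * l := by
      have hchoose : 2 * j.choose 2 + j = j ^ 2 := by
        rw [Nat.choose_two_right, Nat.mul_div_cancel' (Nat.even_mul_pred_self j).two_dvd]
        cases j with
        | zero => rfl
        | succ j => rw [Nat.add_sub_cancel]; ring
      rw [hchoose]
      zify
      rw [sq_abs, ← hj, ← hl]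
      ring
    calc _ = r ^ (3 * n ^ 2 + k.natAbs ^ 2) * (qFactorial (r ^ 2) (2 * n) *
          ((qFactorial (r ^ 2) j)⁻¹ * (qFactorial (r ^ 2) l)⁻¹)) := by rw [pow_add]; ring
      _ = _ := by
        rw [hexp, div_eq_mul_inv, mul_inv]
        ring

lemma qFactorial_two_mul (q : K) (n : ℕ) :
    qFactorial q (2 * n) =
      (∏ i ∈ range n, (1 - q ^ (2 * i + 1))) * qFactorial (q ^ 2) n := by
  induction n with
  | zero => simp [qFactorial]
  | succ n ih =>
    rw [qFactorial, mul_add_one, prod_range_succ, prod_range_succ, ← qFactorial, ih,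
      prod_range_succ, qFactorial, qFactorial, prod_range_succ]
    ring

end Field

section Complex

variable {q : ℂ}

lemma one_sub_pow_succ_ne_zero (hq : ‖q‖ < 1) (n : ℕ) : 1 - q ^ (n + 1) ≠ 0 := by
  intro h
  have h1 : ‖q‖ ^ (n + 1) = 1 := by rw [← norm_pow, ← sub_eq_zero.mp h, norm_one]
  exact (pow_lt_one₀ (norm_nonneg q) hq n.succ_ne_zero).ne h1

lemma qFactorial_ne_zero (hq : ‖q‖ < 1) (n : ℕ) : qFactorial q n ≠ 0 :=
  prod_ne_zero_iff.mpr fun i _ ↦ one_sub_pow_succ_ne_zero hq i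

lemma tendsto_qFactorial (hq : ‖q‖ < 1) :
    Tendsto (qFactorial q) atTop (𝓝 (∏' n : ℕ, (1 - q ^ (n + 1)))) :=
  (ModularForm.multipliable_one_sub_pow hq).tendsto_prod_tprod_nat

lemma tprod_one_sub_pow_ne_zero (hq : ‖q‖ < 1) : ∏' n : ℕ, (1 - q ^ (n + 1)) ≠ 0 := by
  simp only [sub_eq_add_neg]
  refine tprod_one_add_ne_zero_of_summable (f := fun n ↦ -q ^ (n + 1)) (fun n ↦ ?_) ?_
  · rw [← sub_eq_add_neg]
    exact one_sub_pow_succ_ne_zero hq n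
  · simpa using (summable_nat_add_iff 1).mpr (summable_geometric_of_lt_one (norm_nonneg _) hq)

lemma exists_norm_le_of_tendsto {u : ℕ → ℂ} {l : ℂ} (h : Tendsto u atTop (𝓝 l)) :
    ∃ C, ∀ n, ‖u n‖ ≤ C := by
  obtain ⟨C, hC⟩ := (Metric.isBounded_range_of_tendsto u h).exists_norm_le
  exact ⟨C, fun n ↦ hC _ ⟨n, rfl⟩⟩

lemma summable_norm_pow_natAbs_sq {r : ℂ} (hr : ‖r‖ < 1) :
    Summable fun k : ℤ ↦ ‖r‖ ^ k.natAbs ^ 2 := by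
  have hnat : Summable fun n : ℕ ↦ ‖r‖ ^ n ^ 2 :=
    (summable_geometric_of_lt_one (norm_nonneg r) hr).of_nonneg_of_le (fun n ↦ by positivity)
      fun n ↦ pow_le_pow_of_le_one (norm_nonneg r) hr.le (Nat.le_self_pow two_ne_zero n)
  exact Summable.of_nat_of_neg (by simpa using hnat) (by simpa using hnat)

/-- Tannery's theorem for the finite theta sums. -/
theorem tendsto_tsum_finiteThetaTerm {r : ℂ} (hr : ‖r‖ < 1) :
    Tendsto (fun n ↦ ∑' k, finiteThetaTerm r n k) atTop
      (𝓝 (∑' k : ℤ, r ^ k.natAbs ^ 2 * (∏' n : ℕ, (1 - (r ^ 2) ^ (n + 1)))⁻¹)) := by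
  have hr2 : ‖r ^ 2‖ < 1 := by
    rw [norm_pow]
    exact pow_lt_one₀ (norm_nonneg r) hr two_ne_zero
  have hne := tprod_one_sub_pow_ne_zero hr2
  have hP := tendsto_qFactorial hr2
  have hPinv := hP.inv₀ hne
  obtain ⟨A, hA⟩ := exists_norm_le_of_tendsto hP
  obtain ⟨B, hB⟩ := exists_norm_le_of_tendsto hPinv
  have hA0 : 0 ≤ A := (norm_nonneg _).trans (hA 0)
  have hB0 : 0 ≤ B := (norm_nonneg _).trans (hB 0)
  refine tendsto_tsum_of_dominated_convergence (bound := fun k ↦ ‖r‖ ^ k.natAbs ^ 2 * (A * (B * B)))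
    ((summable_norm_pow_natAbs_sq hr).mul_right _) (fun k ↦ ?_) (Eventually.of_forall fun n k ↦ ?_)
  · have h2 : Tendsto (fun n : ℕ ↦ 2 * n) atTop atTop :=
      tendsto_id.const_mul_atTop' two_pos
    have hadd : Tendsto (fun n : ℕ ↦ (n + k).toNat) atTop atTop :=
      tendsto_atTop.mpr fun b ↦ by
        filter_upwards [eventually_ge_atTop (b + k.natAbs)] with n hn
        omega
    have hsub : Tendsto (fun n : ℕ ↦ (n - k).toNat) atTop atTop :=
      tendsto_atTop.mpr fun b ↦ by
        filter_upwards [eventually_ge_atTop (b + k.natAbs)] with n hn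
        omega
    have hlim := ((hP.comp h2).mul ((hPinv.comp hadd).mul (hPinv.comp hsub))).const_mul
      (r ^ k.natAbs ^ 2)
    rw [mul_inv_cancel_left₀ hne] at hlim
    refine hlim.congr' ?_
    filter_upwards [eventually_ge_atTop k.natAbs] with n hn
    rw [finiteThetaTerm, if_pos (mem_Icc.mpr (by omega))]
    rfl
  · rw [finiteThetaTerm]
    split_ifs
    · rw [norm_mul, norm_mul, norm_mul, norm_pow]
      gcongr
      exacts [hA _, hB _, hB _]
    · rw [norm_zero]
      positivity

/-- Gauss's identity `∑ (-q) ^ n² = (q; q)_∞² / (q²; q²)_∞`. -/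
theorem tsum_neg_pow_natAbs_sq (hq0 : q ≠ 0) (hq : ‖q‖ < 1) :
    ∑' k : ℤ, (-q) ^ k.natAbs ^ 2 =
      (∏' n : ℕ, (1 - q ^ (n + 1))) ^ 2 / ∏' n : ℕ, (1 - (q ^ 2) ^ (n + 1)) := by
  have hq2 : ‖q ^ 2‖ < 1 := by
    rw [norm_pow]
    exact pow_lt_one₀ (norm_nonneg q) hq two_ne_zero
  have hne := tprod_one_sub_pow_ne_zero hq2
  have hleft := tendsto_tsum_finiteThetaTerm (r := -q) (by rwa [norm_neg])
  rw [tsum_mul_right, neg_sq] at hleft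
  have hfin (n : ℕ) : (qFactorial q (2 * n) / qFactorial (q ^ 2) n) ^ 2 =
      ∑' k, finiteThetaTerm (-q) n k := by
    rw [tsum_eq_sum (f := finiteThetaTerm (-q) n) (s := Icc (-n : ℤ) n) fun k hk ↦ if_neg hk,
      sum_finiteThetaTerm (neg_ne_zero.mpr hq0) (by simpa using qFactorial_ne_zero hq2),
      qFactorial_two_mul, mul_div_cancel_right₀ _ (qFactorial_ne_zero hq2 n)]
    congr 1
    refine prod_congr rfl fun i _ ↦ ?_
    rw [Odd.neg_pow ⟨i, rfl⟩, sub_eq_add_neg]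
  have hright := ((((tendsto_qFactorial hq).comp (tendsto_id.const_mul_atTop' two_pos)).div
    (tendsto_qFactorial hq2) hne).pow 2).congr hfin
  have := tendsto_nhds_unique hleft hright
  field_simp at this ⊢
  exact this

end Complex

lemma exp_theta_shift (τ : ℂ) (n : ℤ) :
    cexp (2 * π * I * (n : ℂ) ^ 2 * (τ + 1 / 2)) =
      (-cexp (2 * π * I * τ)) ^ n.natAbs ^ 2 := by
  have h : -cexp (2 * π * I * τ) = cexp (2 * π * I * (τ + 1 / 2)) := by
    rw [show 2 * π * I * (τ + 1 / 2) = 2 * π * I * τ + π * I by ring, Complex.exp_add,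
      exp_pi_mul_I, mul_neg_one]
  have hn : ((n.natAbs ^ 2 : ℕ) : ℂ) = (n : ℂ) ^ 2 := by
    rw [← Int.cast_pow, ← Int.natAbs_sq, ← Nat.cast_pow, Int.cast_natCast]
  rw [h, ← Complex.exp_nat_mul, hn]
  congr 1
  ring

/-- `Θ(τ + 1/2) = η(τ)² / η(2τ)`, equivalently
`Σ_{n ∈ ℤ} (−1)ⁿ q^{n²} = (q;q)_∞² / (q²;q²)_∞`. -/
theorem stmt9 (τ : ℂ) (hτ : 0 < τ.im) :
    jacobiThetaQ (τ + 1 / 2) = dedekindEta τ ^ 2 / dedekindEta (2 * τ) := by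
  set q := cexp (2 * π * I * τ) with hqdef
  have hq : ‖q‖ < 1 := by
    simpa using UpperHalfPlane.norm_exp_two_pi_I_lt_one ⟨τ, hτ⟩
  have hq2 : cexp (2 * π * I * (2 * τ)) = q ^ 2 := by
    rw [hqdef, ← Complex.exp_nat_mul]
    congr 1
    push_cast
    ring
  have hpre : cexp (π * I * (2 * τ) / 12) = cexp (π * I * τ / 12) ^ 2 := by
    rw [← Complex.exp_nat_mul]
    congr 1
    push_cast
    ring
  simp only [jacobiThetaQ, dedekindEta, exp_theta_shift]
  rw [tsum_neg_pow_natAbs_sq (Complex.exp_ne_zero _) hq, hq2, hpre, mul_pow,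
    mul_div_mul_left _ _ (pow_ne_zero 2 (Complex.exp_ne_zero _))]
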